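/- Let s = σ + it with σ > 1 and t real, and set s1 = σ1 + it. If z is a complex number with 0 < Re z < 1, then F(s,z) − κ·F(s1,z) ≥ 0. -/

import Mathlib

namespace ZFR

noncomputable def kappa : ℝ := 1 / Real.sqrt 5

noncomputable def sigma1 (σ : ℝ) : ℝ := 1 / 2 + Real.sqrt (1 + 4 * σ ^ 2) / 2

/-- `F(s,z) = Re( 1/(s-z) + 1/(s-1+conj z) )`. -/
noncomputable def F (s z : ℂ) : ℝ :=
  (1 / (s - z) + 1 / (s - 1 + (starRingEnd ℂ) z)).re

theorem F_eq (σ t : ℝ) (z : ℂ) (h0 : 0 < σ - z.re) (h1 : 0 < σ - 1 + z.re) :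
    F ((σ : ℂ) + (t : ℂ) * Complex.I) z =
      2 * (σ - 1 / 2) * ((σ - 1 / 2) ^ 2 - (z.re - 1 / 2) ^ 2 + (t - z.im) ^ 2) /
        (((σ - 1 / 2) ^ 2 - (z.re - 1 / 2) ^ 2 + (t - z.im) ^ 2) ^ 2
          + 4 * (z.re - 1 / 2) ^ 2 * (t - z.im) ^ 2) := by
  have ha : 0 < (σ - z.re) ^ 2 + (t - z.im) ^ 2 := by positivity
  have hb : 0 < (σ - 1 + z.re) ^ 2 + (t - z.im) ^ 2 := by positivity
  have hF : F ((σ : ℂ) + (t : ℂ) * Complex.I) z =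
      (σ - z.re) / ((σ - z.re) ^ 2 + (t - z.im) ^ 2)
        + (σ - 1 + z.re) / ((σ - 1 + z.re) ^ 2 + (t - z.im) ^ 2) := by
    simp [F, Complex.inv_re, Complex.normSq_apply, pow_two, ← sub_eq_add_neg]
  have hD : ((σ - 1 / 2) ^ 2 - (z.re - 1 / 2) ^ 2 + (t - z.im) ^ 2) ^ 2
      + 4 * (z.re - 1 / 2) ^ 2 * (t - z.im) ^ 2 =
      ((σ - z.re) ^ 2 + (t - z.im) ^ 2) * ((σ - 1 + z.re) ^ 2 + (t - z.im) ^ 2) := by ring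
  rw [hF, hD, div_add_div _ _ ha.ne' hb.ne']
  congr 1
  ring

theorem sigma1_sub_half_sq (σ : ℝ) : (sigma1 σ - 1 / 2) ^ 2 = 1 / 4 + σ ^ 2 := by
  have h := Real.sq_sqrt (show 0 ≤ 1 + 4 * σ ^ 2 by positivity)
  unfold sigma1
  linear_combination h / 4

theorem lt_sigma1_sub_half (σ : ℝ) : σ < sigma1 σ - 1 / 2 := by
  have h : 2 * σ < √(1 + 4 * σ ^ 2) := Real.lt_sqrt_of_sq_lt (by nlinarith)
  unfold sigma1
  linarith

theorem kappa_mul_sigma1_sub_half_le {σ : ℝ} (hσ : 1 ≤ σ) :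
    kappa * (sigma1 σ - 1 / 2) ≤ σ - 1 / 2 := by
  have hk : kappa ^ 2 = 1 / 5 := by
    rw [kappa, div_pow, Real.sq_sqrt (by norm_num), one_pow]
  refine (abs_le_of_sq_le_sq' ?_ (by linarith)).2
  rw [mul_pow, hk, sigma1_sub_half_sq]
  nlinarith

/-- Stechkin's lemma, first inequality: for `s = σ + it` with `σ > 1`,
`s1 = σ1 + it`, and `0 < Re z < 1`, one has `F(s,z) - κ F(s1,z) ≥ 0`. -/
theorem stechkin_first (σ t : ℝ) (hσ : 1 < σ) (z : ℂ) (h0 : 0 < z.re) (h1 : z.re < 1) :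
    0 ≤ F ((σ : ℂ) + (t : ℂ) * Complex.I) z
        - kappa * F ((sigma1 σ : ℂ) + (t : ℂ) * Complex.I) z := by
  have hlt := lt_sigma1_sub_half σ
  have hsq := sigma1_sub_half_sq σ
  have hku := kappa_mul_sigma1_sub_half_le hσ.le
  rw [F_eq σ t z (by linarith) (by linarith), F_eq (sigma1 σ) t z (by linarith) (by linarith), hsq]
  have hw : 4 * (z.re - 1 / 2) ^ 2 ≤ 1 := by nlinarith
  have hu : 1 / 4 < (σ - 1 / 2) ^ 2 := by nlinarith
  have hY := sq_nonneg (t - z.im)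
  have hw0 := sq_nonneg (z.re - 1 / 2)
  generalize (t - z.im) ^ 2 = Y at *
  generalize (z.re - 1 / 2) ^ 2 = w at *
  obtain ⟨P, hP⟩ : ∃ P, P = (σ - 1 / 2) ^ 2 - w + Y := ⟨_, rfl⟩
  obtain ⟨Q, hQ⟩ : ∃ Q, Q = 1 / 4 + σ ^ 2 - w + Y := ⟨_, rfl⟩
  rw [← hP, ← hQ]
  have hYP : Y < P := by linarith
  have hP0 : 0 < P := by linarith
  have hQ1 : 1 ≤ Q := by nlinarith
  have hPQ : P ≤ Q := by nlinarith
  have hYPQ : 4 * w * Y ≤ P * Q := by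
    calc 4 * w * Y ≤ 1 * Y := by gcongr
      _ ≤ P * 1 := by linarith
      _ ≤ P * Q := by gcongr
  have hfrac : Q / (Q ^ 2 + 4 * w * Y) ≤ P / (P ^ 2 + 4 * w * Y) := by
    rw [div_le_div_iff₀ (by positivity) (by positivity)]
    nlinarith [mul_nonneg (sub_nonneg.2 hPQ) (sub_nonneg.2 hYPQ)]
  have hmul := mul_le_mul hku hfrac (by positivity) (by linarith)
  rw [mul_div_assoc, mul_div_assoc]
  linarith

end ZFR
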